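/- Choquet's capacitability theorem for ~cap_p: let p > 1. Then every Borel set (and even every Suslin set) A ⊂ E for which there exists a locally compact set F with A ⊂ F ⊂ E is capacitable for ~cap_p, i.e. ~cap_p(A,E) = sup { ~cap_p(K,E) : K compact, K ⊂ A } = inf { ~cap_p(G,E) : G relatively open in E, A ⊂ G ⊂ E }. In particular, if E itself is locally compact (e.g. open or compact), this holds for all Borel A ⊂ E. No additional assumptions on X are needed. -/

import Mathlib

open MeasureTheory Metric Set Filter
open scoped ENNReal NNReal Topology

noncomputable section

variable {X : Type*} [MetricSpace X] [MeasurableSpace X] [BorelSpace X]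

/-- A nonconstant, compact, rectifiable curve in `X`, parameterized by arc length on
`[0, len]`. The arc-length parameterization is expressed by requiring that the length
(total variation) of the curve on each subinterval `[s, t]` equals `t - s`. -/
structure Curve (X : Type*) [MetricSpace X] where
  len : ℝ
  len_pos : 0 < len
  toFun : ℝ → X
  continuousOn : ContinuousOn toFun (Set.Icc 0 len)
  arclength : ∀ s t : ℝ, s ∈ Set.Icc 0 len → t ∈ Set.Icc 0 len → s ≤ t →
    eVariationOn toFun (Set.Icc s t) = ENNReal.ofReal (t - s)
  nonconstant : ∃ s ∈ Set.Icc 0 len, ∃ t ∈ Set.Icc 0 len, toFun s ≠ toFun t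

/-- The curve integral `∫_γ g ds` of a nonnegative function along an arc-length
parameterized curve. -/
def Curve.integral (γ : Curve X) (g : X → ℝ≥0∞) : ℝ≥0∞ :=
  ∫⁻ t in Set.Icc (0 : ℝ) γ.len, g (γ.toFun t)

/-- `|a - b|` with the convention that it is `∞` whenever both `a` and `b` are infinite. -/
def ugDiff (a b : EReal) : ℝ≥0∞ :=
  if a.abs = ⊤ ∨ b.abs = ⊤ then ⊤ else (a - b).abs

/-- The upper gradient inequality for `f` and `g` along the curve `γ`. -/
def UGOn (f : X → EReal) (g : X → ℝ≥0∞) (γ : Curve X) : Prop :=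
  ugDiff (f (γ.toFun 0)) (f (γ.toFun γ.len)) ≤ γ.integral g

/-- A curve family has zero `p`-modulus. -/
def ZeroModulus (p : ℝ) (μ : Measure X) (Γ : Set (Curve X)) : Prop :=
  ∃ ρ : X → ℝ≥0∞, Measurable ρ ∧ (∫⁻ x, ρ x ^ p ∂μ) < ⊤ ∧ ∀ γ ∈ Γ, γ.integral ρ = ⊤

/-- `g` is an upper gradient of `f`. -/
def IsUpperGradient (f : X → EReal) (g : X → ℝ≥0∞) : Prop :=
  Measurable g ∧ ∀ γ : Curve X, UGOn f g γ

/-- `g` is a `p`-weak upper gradient of `f`: the upper gradient inequality holds for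
`p`-almost every curve. -/
def IsWeakUpperGradient (p : ℝ) (μ : Measure X) (f : X → EReal) (g : X → ℝ≥0∞) : Prop :=
  Measurable g ∧ ZeroModulus p μ {γ : Curve X | ¬ UGOn f g γ}

/-- The energy `∫_X g_u^p dμ` of the minimal `p`-weak upper gradient of `u`, expressed as
the infimum of `∫_X g^p dμ` over all `p`-weak upper gradients `g` of `u`
(`= ∞` if `u` has no `p`-weak upper gradient). -/
def gradEnergy (p : ℝ) (μ : Measure X) (u : X → EReal) : ℝ≥0∞ :=
  ⨅ (g : X → ℝ≥0∞) (_ : IsWeakUpperGradient p μ u g), ∫⁻ x, g x ^ p ∂μ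

/-- The Newtonian energy `‖u‖_{N^{1,p}(X)}^p = ∫_X |u|^p dμ + ∫_X g_u^p dμ`. -/
def newtonianEnergy (p : ℝ) (μ : Measure X) (u : X → EReal) : ℝ≥0∞ :=
  (∫⁻ x, (u x).abs ^ p ∂μ) + gradEnergy p μ u

/-- Membership in the Newtonian space `N^{1,p}(X)` (measurability is with respect to the
completion of the Borel σ-algebra, i.e. a.e.-measurability). -/
def MemNewtonian (p : ℝ) (μ : Measure X) (u : X → EReal) : Prop :=
  AEMeasurable u μ ∧ newtonianEnergy p μ u < ⊤

/-- Membership in `N^{1,p}_0(E)`, members being regarded as functions on all of `X`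
that vanish outside `E`. -/
def MemNewtonian0 (p : ℝ) (μ : Measure X) (E : Set X) (u : X → EReal) : Prop :=
  MemNewtonian p μ u ∧ ∀ x ∉ E, u x = 0

/-- The Sobolev capacity `C_p(A)`. -/
def sobolevCapacity (p : ℝ) (μ : Measure X) (A : Set X) : ℝ≥0∞ :=
  ⨅ (u : X → EReal) (_ : MemNewtonian p μ u ∧ ∀ x ∈ A, u x = 1), newtonianEnergy p μ u

/-- The variational capacity `cap_p(A, E)`. -/
def varCapacity (p : ℝ) (μ : Measure X) (A E : Set X) : ℝ≥0∞ :=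
  ⨅ (u : X → EReal) (_ : MemNewtonian0 p μ E u ∧ ∀ x ∈ A, 1 ≤ u x), gradEnergy p μ u

/-- A function is quasicontinuous if outside open sets of arbitrarily small Sobolev
capacity it is real-valued and continuous. -/
def QuasicontinuousFun (p : ℝ) (μ : Measure X) (u : X → EReal) : Prop :=
  ∀ ε : ℝ≥0∞, 0 < ε → ∃ G : Set X, IsOpen G ∧ sobolevCapacity p μ G < ε ∧
    (∀ x ∈ Gᶜ, u x ≠ ⊤ ∧ u x ≠ ⊥) ∧ ContinuousOn u Gᶜ

/-- The capacity `~cap_p(A,E)`: the infimum of `cap_p(G,E)` over all relatively open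
subsets `G` of `E` containing `A`. -/
def varCapacityT (p : ℝ) (μ : Measure X) (A E : Set X) : ℝ≥0∞ :=
  ⨅ (G : Set X) (_ : A ⊆ G ∧ G ⊆ E ∧ ∃ U : Set X, IsOpen U ∧ G = U ∩ E),
    varCapacity p μ G E


theorem exists_rpow_sub_add_le_real {p : ℝ} (hp : 1 < p) {ε : ℝ} (hε : 0 < ε) :
    ∃ C : ℝ, 0 ≤ C ∧ ∀ t ∈ Icc (0 : ℝ) 1,
      (1 - t) ^ p + C * ((t + 1) / 2) ^ p ≤ ε + C * ((t ^ p + 1) / 2) := by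
  have hp0 : 0 < p := by linarith
  have hconv : ∀ t ∈ Icc (0 : ℝ) 1, ((t + 1) / 2) ^ p ≤ (t ^ p + 1) / 2 := fun t ht => by
    have := (strictConvexOn_rpow hp).convexOn.2 (mem_Ici.2 ht.1)
      (mem_Ici.2 (zero_le_one' ℝ)) (one_half_pos (α := ℝ)).le one_half_pos.le (add_halves 1)
    simp only [smul_eq_mul, Real.one_rpow] at this
    have e : (t + 1) / 2 = 1 / 2 * t + 1 / 2 * 1 := by ring
    rw [e]; linarith
  have hstrict : ∀ t ∈ Icc (0 : ℝ) 1, t ≠ 1 → 0 < (t ^ p + 1) / 2 - ((t + 1) / 2) ^ p :=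
      fun t ht h1 => by
    have := (strictConvexOn_rpow hp).2 (mem_Ici.2 ht.1)
      (mem_Ici.2 (zero_le_one' ℝ)) h1 (one_half_pos (α := ℝ)) one_half_pos (add_halves 1)
    simp only [smul_eq_mul, Real.one_rpow] at this
    have e : (t + 1) / 2 = 1 / 2 * t + 1 / 2 * 1 := by ring
    rw [e]; linarith
  have hpow : Continuous fun t : ℝ => t ^ p := Real.continuous_rpow_const hp0.le
  let K : Set ℝ := Icc (0 : ℝ) 1 ∩ {t | ε ≤ (1 - t) ^ p}
  have hK : IsCompact K := isCompact_Icc.inter_right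
    (isClosed_le continuous_const (hpow.comp (continuous_const.sub continuous_id)))
  have hcont : Continuous fun t : ℝ => (t ^ p + 1) / 2 - ((t + 1) / 2) ^ p :=
    ((hpow.add continuous_const).div_const 2).sub
      (hpow.comp ((continuous_id.add continuous_const).div_const 2))
  obtain ⟨δ, hδ, hmin⟩ : ∃ δ, 0 < δ ∧ ∀ t ∈ K, δ ≤ (t ^ p + 1) / 2 - ((t + 1) / 2) ^ p := by
    refine hK.exists_forall_le' hcont.continuousOn fun t ht => hstrict t ht.1 ?_
    rintro rfl
    have h := ht.2
    simp only [mem_ofPred_eq, sub_self, Real.zero_rpow hp0.ne'] at h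
    linarith
  refine ⟨δ⁻¹, by positivity, fun t ht => ?_⟩
  by_cases hK' : t ∈ K
  · have h1 : (1 - t) ^ p ≤ 1 := Real.rpow_le_one (by linarith [ht.2]) (by linarith [ht.1]) hp0.le
    have h2 : 1 ≤ δ⁻¹ * ((t ^ p + 1) / 2 - ((t + 1) / 2) ^ p) := by
      rw [inv_mul_eq_div, one_le_div hδ]
      exact hmin t hK'
    linarith
  · have h1 : (1 - t) ^ p < ε := by
      by_contra h
      exact hK' ⟨ht, not_lt.1 h⟩
    have := mul_le_mul_of_nonneg_left (hconv t ht) (inv_nonneg.2 hδ.le)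
    linarith

/-- A quantitative form of the strict convexity of `t ↦ t ^ p`. -/
theorem exists_rpow_tsub_add_le {p : ℝ} (hp : 1 < p) {ε : ℝ≥0} (hε : 0 < ε) :
    ∃ C : ℝ≥0, ∀ a b : ℝ≥0∞,
      (b - a) ^ p + C * ((a + b) / 2) ^ p ≤ ε * (a ^ p + b ^ p) + C * ((a ^ p + b ^ p) / 2) := by
  have hp0 : 0 < p := by linarith
  obtain ⟨C, hC, h⟩ := exists_rpow_sub_add_le_real hp (ε := ε) (by exact_mod_cast hε)
  lift C to ℝ≥0 using hC
  refine ⟨C, fun a b => ?_⟩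
  rcases eq_or_ne a ⊤ with rfl | ha
  · simp [hp0, hε.ne']
  rcases eq_or_ne b ⊤ with rfl | hb
  · simp [hp0, hε.ne']
  rcases le_total b a with hba | hab
  · rw [tsub_eq_zero_of_le hba, ENNReal.zero_rpow_of_pos hp0, zero_add]
    refine le_add_left (mul_le_mul_right ?_ _)
    have := ENNReal.rpow_arith_mean_le_arith_mean2_rpow (1 / 2) (1 / 2) a b
      (by rw [ENNReal.add_halves]) hp.le
    simp only [← mul_add] at this
    simpa only [ENNReal.div_eq_inv_mul, mul_one] using this
  · lift a to ℝ≥0 using ha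
    lift b to ℝ≥0 using hb
    norm_cast at hab
    rcases eq_or_ne b 0 with rfl | hb0
    · have : a = 0 := le_antisymm hab (zero_le)
      simp [this, hp0]
    have key : (b - a) ^ p + C * ((a + b) / 2) ^ p
        ≤ ε * (a ^ p + b ^ p) + C * ((a ^ p + b ^ p) / 2) := by
      rw [← NNReal.coe_le_coe]
      push_cast [NNReal.coe_sub hab]
      have hbpos : (0 : ℝ) < b := by positivity
      have hle : (a : ℝ) ≤ b := by exact_mod_cast hab
      have hbp : (0 : ℝ) < (b : ℝ) ^ p := by positivity
      have h' := h (a / b) ⟨by positivity, (div_le_one hbpos).2 hle⟩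
      have h'' := mul_le_mul_of_nonneg_left h' hbp.le
      have e1 : (b : ℝ) ^ p * (1 - a / b) ^ p = (b - a) ^ p := by
        rw [← Real.mul_rpow hbpos.le (by rw [sub_nonneg]; exact (div_le_one hbpos).2 hle)]
        congr 1; field_simp
      have e2 : (b : ℝ) ^ p * ((a / b + 1) / 2) ^ p = ((a + b) / 2) ^ p := by
        rw [← Real.mul_rpow hbpos.le (by positivity)]
        congr 1; field_simp
      have e3 : (b : ℝ) ^ p * (a / b) ^ p = a ^ p := by
        rw [← Real.mul_rpow hbpos.le (by positivity)]
        congr 1; field_simp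
      have e4 : (0 : ℝ) ≤ ε * a ^ p := by positivity
      calc _ = (b : ℝ) ^ p * ((1 - a / b) ^ p + C * ((a / b + 1) / 2) ^ p) := by
            rw [← e1, ← e2]; ring
        _ ≤ (b : ℝ) ^ p * (ε + C * (((a / b) ^ p + 1) / 2)) := h''
        _ = ε * b ^ p + C * ((b ^ p * (a / b) ^ p + b ^ p) / 2) := by ring
        _ ≤ _ := by rw [e3]; linarith
    have hcast : ((2 : ℝ≥0) : ℝ≥0∞) = 2 := rfl
    rw [← hcast]
    simp only [← ENNReal.coe_rpow_of_nonneg _ hp0.le, ← ENNReal.coe_add,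
      ← ENNReal.coe_div (two_ne_zero : (2 : ℝ≥0) ≠ 0), ← ENNReal.coe_sub, ← ENNReal.coe_mul]
    exact_mod_cast key

theorem eventually_lintegral_rpow_tsub_le {α : Type*} [MeasurableSpace α] {ν : Measure α} {p : ℝ}
    (hp : 1 < p) {g : ℕ → α → ℝ≥0∞} (hg : ∀ n, Measurable (g n)) {c e : ℕ → ℝ≥0∞} {d : ℝ≥0∞}
    (hd : d ≠ ⊤) (hcd : ∀ n, c n ≤ d) (hc : Tendsto c atTop (𝓝 d)) (he : Tendsto e atTop (𝓝 0))
    (hgd : ∀ n, ∫⁻ x, g n x ^ p ∂ν ≤ d + e n)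
    (hmid : ∀ i m, i ≤ m → c i ≤ ∫⁻ x, ((g i x + g m x) / 2) ^ p ∂ν)
    {η : ℝ≥0∞} (hη : η ≠ 0) :
    ∃ N, ∀ i ≥ N, ∀ m ≥ i, ∫⁻ x, (g m x - g i x) ^ p ∂ν ≤ η := by
  have hη2 : η / 2 ≠ 0 := by simpa using hη
  obtain ⟨ε, hε, hεη⟩ := ENNReal.exists_nnreal_pos_mul_lt (a := 2 * (d + 1))
    (by finiteness) hη2
  obtain ⟨C, hC⟩ := exists_rpow_tsub_add_le hp hε
  obtain ⟨s, hs, hsη⟩ := ENNReal.exists_nnreal_pos_mul_lt (a := 2 * C) (by finiteness) hη2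
  let r : ℝ≥0∞ := min s 1
  have hr : 0 < r := by simp [r, hs]
  have hrtop : r ≠ ⊤ := (min_le_right _ _).trans_lt ENNReal.one_lt_top |>.ne
  have hc' : Tendsto (fun n => c n + r) atTop (𝓝 (d + r)) := hc.add_const r
  obtain ⟨N, hN⟩ := eventually_atTop.1 ((hc'.eventually_const_lt
    (ENNReal.lt_add_right hd hr.ne')).and (he.eventually_lt_const hr))
  refine ⟨N, fun i hi m hm => ?_⟩
  have hIi : ∫⁻ x, g i x ^ p ∂ν ≤ d + r := (hgd i).trans (by gcongr; exact (hN i hi).2.le)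
  have hIm : ∫⁻ x, g m x ^ p ∂ν ≤ d + r :=
    (hgd m).trans (by gcongr; exact (hN m (hi.trans hm)).2.le)
  have hgi := (hg i).pow_const p
  have hgm := (hg m).pow_const p
  have hgs : Measurable fun x => (g m x - g i x) ^ p := ((hg m).sub (hg i)).pow_const p
  have hga : Measurable fun x => g i x ^ p + g m x ^ p := hgi.add hgm
  have hgc : Measurable fun x => (2⁻¹ * (g i x + g m x)) ^ p :=
    (((hg i).add (hg m)).const_mul _).pow_const p
  have hint : ∫⁻ x, (g m x - g i x) ^ p ∂ν + C * ∫⁻ x, ((g i x + g m x) / 2) ^ p ∂ν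
      ≤ ε * (∫⁻ x, g i x ^ p ∂ν + ∫⁻ x, g m x ^ p ∂ν)
        + C * ((∫⁻ x, g i x ^ p ∂ν + ∫⁻ x, g m x ^ p ∂ν) / 2) := by
    have := lintegral_mono (μ := ν) fun x => hC (g i x) (g m x)
    simp only [ENNReal.div_eq_inv_mul] at this ⊢
    rw [lintegral_add_left hgs,
      lintegral_const_mul _ hgc,
      lintegral_add_left (hga.const_mul _), lintegral_const_mul _ hga,
      lintegral_const_mul _ (hga.const_mul _),
      lintegral_const_mul _ hga, lintegral_add_left hgi] at this
    exact this
  have hci : c i ≠ ⊤ := ((hcd i).trans_lt hd.lt_top).ne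
  refine ENNReal.le_of_add_le_add_right (a := C * c i) (by finiteness) ?_
  calc _ ≤ ∫⁻ x, (g m x - g i x) ^ p ∂ν + C * ∫⁻ x, ((g i x + g m x) / 2) ^ p ∂ν := by
        gcongr; exact hmid i m hm
    _ ≤ ε * ((d + r) + (d + r)) + C * (((d + r) + (d + r)) / 2) := by
        refine hint.trans ?_
        gcongr
    _ = ε * (2 * (d + r)) + C * (d + r) := by
        rw [← two_mul, ENNReal.mul_div_right_comm, ENNReal.div_self two_ne_zero (by simp), one_mul]
    _ ≤ ε * (2 * (d + 1)) + C * ((c i + r) + r) := by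
        gcongr
        · exact min_le_right _ _
        · exact (hN i hi).1.le
    _ = ε * (2 * (d + 1)) + r * (2 * C) + C * c i := by ring
    _ ≤ η / 2 + η / 2 + C * c i := by
        gcongr
        refine le_trans ?_ hsη.le
        gcongr
        exact min_le_left _ _
    _ = η + C * c i := by rw [ENNReal.add_halves]

theorem exists_subseq_lintegral_iSup_rpow_le {α : Type*} [MeasurableSpace α] {ν : Measure α} {p : ℝ}
    (hp : 1 < p) {g : ℕ → α → ℝ≥0∞} (hg : ∀ n, Measurable (g n)) {c e : ℕ → ℝ≥0∞} {d d' : ℝ≥0∞}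
    (hd : d < d') (hcd : ∀ n, c n ≤ d) (hc : Tendsto c atTop (𝓝 d)) (he : Tendsto e atTop (𝓝 0))
    (hgd : ∀ n, ∫⁻ x, g n x ^ p ∂ν ≤ d + e n)
    (hmid : ∀ i m, i ≤ m → c i ≤ ∫⁻ x, ((g i x + g m x) / 2) ^ p ∂ν) :
    ∃ k : ℕ → ℕ, StrictMono k ∧ ∫⁻ x, (⨆ j, g (k j) x) ^ p ∂ν ≤ d' := by
  have hp0 : 0 < p := by linarith
  obtain ⟨b, hdb, hbd⟩ := exists_between hd
  have hroot : b ^ (1 / p) < d' ^ (1 / p) := ENNReal.rpow_lt_rpow hbd (by positivity)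
  obtain ⟨δ, hδ, hsum⟩ := ENNReal.exists_pos_sum_of_countable'
    (tsub_pos_of_lt hroot).ne' ℕ
  obtain ⟨k, hk, hkp⟩ := extraction_forall_of_eventually'
    (P := fun j i => (∀ m ≥ i, ∫⁻ x, (g m x - g i x) ^ p ∂ν ≤ δ j ^ p) ∧
      ∫⁻ x, g i x ^ p ∂ν ≤ b) (fun j => by
    obtain ⟨N, hN⟩ := eventually_lintegral_rpow_tsub_le hp hg hd.ne_top hcd hc he hgd hmid
      (η := δ j ^ p) (by simpa [hp0, hp0.le] using (hδ j).ne')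
    have hlim : Tendsto (fun n => d + e n) atTop (𝓝 (d + 0)) := he.const_add d
    rw [add_zero] at hlim
    obtain ⟨N', hN'⟩ := eventually_atTop.1 (hlim.eventually_lt_const hdb)
    exact ⟨max N N', fun i hi => ⟨hN i (le_of_max_le_left hi),
      (hgd i).trans (hN' i (le_of_max_le_right hi)).le⟩⟩)
  refine ⟨k, hk, ?_⟩
  let M := partialSups fun j => g (k j)
  have hM : ∀ n, Measurable (M n) := fun n => by
    induction n with
    | zero => simpa [M] using hg (k 0)
    | succ n ih => simpa only [M, partialSups_add_one] using ih.sup (hg (k (n + 1)))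
  have hnorm : ∀ n, (∫⁻ x, M n x ^ p ∂ν) ^ (1 / p) ≤ b ^ (1 / p) + ∑ j ∈ Finset.range n, δ j := by
    intro n
    induction n with
    | zero =>
      simp only [M, partialSups_zero, Finset.range_zero, Finset.sum_empty, add_zero]
      exact ENNReal.rpow_le_rpow (hkp 0).2 (by positivity)
    | succ n ih =>
      have hstep : ∀ x, M (n + 1) x ≤ (M n + fun x => g (k (n + 1)) x - g (k n) x) x := fun x => by
        simp only [M, partialSups_add_one, Pi.sup_apply, Pi.add_apply]
        refine sup_le le_self_add ((le_add_tsub (b := g (k n) x)).trans ?_)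
        gcongr
        exact le_partialSups (fun j => g (k j)) n x
      calc _ ≤ (∫⁻ x, (M n + fun x => g (k (n + 1)) x - g (k n) x) x ^ p ∂ν) ^ (1 / p) := by
            gcongr with x
            exact hstep x
        _ ≤ _ := ENNReal.lintegral_Lp_add_le (hM n).aemeasurable
            ((hg _).sub (hg _)).aemeasurable hp.le
        _ ≤ (b ^ (1 / p) + ∑ j ∈ Finset.range n, δ j) + (δ n ^ p) ^ (1 / p) := by
            gcongr
            exact (hkp n).1 _ (hk n.lt_succ_self).le
        _ = _ := by
            rw [Finset.sum_range_succ, ← ENNReal.rpow_mul, mul_one_div_cancel hp0.ne',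
              ENNReal.rpow_one, add_assoc]
  have hMd : ∀ n, ∫⁻ x, M n x ^ p ∂ν ≤ d' := fun n => by
    have h1 : (∫⁻ x, M n x ^ p ∂ν) ^ (1 / p) ≤ d' ^ (1 / p) :=
      calc _ ≤ b ^ (1 / p) + ∑ j ∈ Finset.range n, δ j := hnorm n
        _ ≤ b ^ (1 / p) + (d' ^ (1 / p) - b ^ (1 / p)) := by
            gcongr
            exact (ENNReal.sum_le_tsum _).trans hsum.le
        _ = _ := add_tsub_cancel_of_le hroot.le
    exact (ENNReal.rpow_le_rpow_iff (by positivity)).1 h1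
  have hsup : ∀ x, (⨆ j, g (k j) x) ^ p = ⨆ n, M n x ^ p := fun x => by
    have h1 : (⨆ j, g (k j) x) = ⨆ n, M n x := by
      have := congrFun (iSup_partialSups_eq fun j => g (k j)) x
      simpa only [iSup_apply] using this.symm
    rw [h1]
    exact (ENNReal.orderIsoRpow p hp0).map_iSup _
  simp only [hsup]
  rw [lintegral_iSup (fun n => (hM n).pow_const p)
    (fun i j hij x => ENNReal.rpow_le_rpow (M.mono hij x) hp0.le)]
  exact iSup_le hMd

theorem exists_finite_prefix_subset_of_isOpen {n : ℕ → ℕ} {V : Set (ℕ → ℕ)} (hV : IsOpen V)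
    (hnV : (univ.pi fun i => Iic (n i)) ⊆ V) :
    ∃ k, {σ : ℕ → ℕ | ∀ i < k, σ i ≤ n i} ⊆ V := by
  have hL : IsCompact (univ.pi fun i => Iic (n i)) :=
    isCompact_univ_pi fun i => (finite_Iic (n i)).isCompact
  obtain ⟨k, hk⟩ : ∃ k, ∀ σ : ℕ → ℕ, ∀ τ ∈ univ.pi fun i => Iic (n i),
      (∀ i < k, σ i = τ i) → σ ∈ V := by
    refine hL.induction_on (p := fun s => ∃ k, ∀ σ : ℕ → ℕ, ∀ τ ∈ s,
      (∀ i < k, σ i = τ i) → σ ∈ V) ⟨0, by simp⟩ ?_ ?_ ?_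
    · rintro s t hst ⟨k, hk⟩
      exact ⟨k, fun σ τ hτ => hk σ τ (hst hτ)⟩
    · rintro s t ⟨k, hk⟩ ⟨l, hl⟩
      refine ⟨max k l, fun σ τ hτ h => ?_⟩
      rcases hτ with hτ | hτ
      · exact hk σ τ hτ fun i hi => h i (lt_max_of_lt_left hi)
      · exact hl σ τ hτ fun i hi => h i (lt_max_of_lt_right hi)
    · intro x hx
      obtain ⟨_, ⟨y, k, rfl⟩, hxy, hyV⟩ :=
        (PiNat.isTopologicalBasis_cylinders fun _ : ℕ => ℕ).isOpen_iff.1 hV x (hnV hx)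
      refine ⟨_, mem_nhdsWithin_of_mem_nhds ((PiNat.isOpen_cylinder _ y k).mem_nhds hxy), k,
        fun σ τ hτ h => hyV fun i hi => (h i hi).trans (hτ i hi)⟩
  refine ⟨k, fun σ hσ => hk σ (fun i => min (σ i) (n i)) (fun i _ => mem_Iic.2 (min_le_right _ _))
    fun i hi => (min_eq_left (hσ i hi)).symm⟩

/-- **Choquet's capacitability theorem** for analytic sets. -/
theorem MeasureTheory.AnalyticSet.le_iSup_isCompact_of_capacity {Y : Type*} [TopologicalSpace Y]
    {A : Set Y} (hA : AnalyticSet A) {C : Set Y → ℝ≥0∞} (hmono : Monotone C)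
    (hup : ∀ s : ℕ → Set Y, Monotone s → C (⋃ n, s n) ≤ ⨆ n, C (s n))
    (hout : ∀ K ⊆ A, IsCompact K → ∀ t, C K < t → ∃ U, IsOpen U ∧ K ⊆ U ∧ C (U ∩ A) < t) :
    C A ≤ ⨆ (K : Set Y) (_ : IsCompact K ∧ K ⊆ A), C K := by
  rw [AnalyticSet] at hA
  rcases hA with rfl | ⟨f, hf, rfl⟩
  · exact le_iSup₂_of_le ∅ ⟨isCompact_empty, Subset.rfl⟩ le_rfl
  refine le_of_forall_lt fun t ht => ?_
  obtain ⟨t', htt', ht'⟩ := exists_between ht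
  have hstep : ∀ (k : ℕ) (S : {S : Set (ℕ → ℕ) // t' < C (f '' S)}),
      ∃ m, t' < C (f '' (S ∩ {σ | σ k ≤ m})) := by
    rintro k ⟨S, hS⟩
    have hS' : f '' S = ⋃ m, f '' (S ∩ {σ | σ k ≤ m}) := by
      rw [← image_iUnion, ← inter_iUnion]
      congr 1
      exact (inter_eq_left.2 fun σ _ => mem_iUnion.2 ⟨σ k, le_refl (σ k)⟩).symm
    rw [hS'] at hS
    exact lt_iSup_iff.1 (hS.trans_le (hup _ fun m m' hm => image_mono
      (inter_subset_inter_right _ fun σ hσ => le_trans hσ hm)))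
  choose m hm using hstep
  let S : ℕ → {S : Set (ℕ → ℕ) // t' < C (f '' S)} := fun k =>
    Nat.rec ⟨univ, by rwa [image_univ]⟩ (fun k S => ⟨S.1 ∩ {σ | σ k ≤ m k S}, hm k S⟩) k
  let n : ℕ → ℕ := fun k => m k (S k)
  have hS : ∀ k, (S k).1 = {σ | ∀ i < k, σ i ≤ n i} := by
    intro k
    induction k with
    | zero => ext; simp [S]
    | succ k ih =>
      have h : (S (k + 1)).1 = (S k).1 ∩ {σ | σ k ≤ n k} := rfl
      rw [h, ih]
      ext σ
      simp only [mem_inter_iff, mem_ofPred_eq, Nat.forall_lt_succ_right]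
  have hK : IsCompact (f '' univ.pi fun i => Iic (n i)) :=
    (isCompact_univ_pi fun i => (finite_Iic (n i)).isCompact).image hf
  have hKA := image_subset_range f (univ.pi fun i => Iic (n i))
  refine htt'.trans_le (le_iSup₂_of_le _ ⟨hK, hKA⟩ ?_)
  by_contra! hlt
  obtain ⟨U, hU, hKU, hUt⟩ := hout _ hKA hK t' hlt
  obtain ⟨k, hk⟩ := exists_finite_prefix_subset_of_isOpen (hU.preimage hf) (image_subset_iff.1 hKU)
  rw [← hS] at hk
  exact ((S k).2.trans_le (hmono (subset_inter (image_subset_iff.2 hk)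
    (image_subset_range _ _)))).not_gt hUt

theorem MeasurableSet.analyticSet_of_subset_locallyCompact {Y : Type*} [MetricSpace Y] [MeasurableSpace Y]
    [BorelSpace Y] [SecondCountableTopology Y] {A F : Set Y} (hA : MeasurableSet A) (hAF : A ⊆ F)
    [LocallyCompactSpace F] : AnalyticSet A := by
  have h : A = ⋃ n, (fun x : (compactCovering F n) => ((x : F) : Y)) ''
      ((fun x : (compactCovering F n) => ((x : F) : Y)) ⁻¹' A) := by
    ext x
    simp only [mem_iUnion, mem_image, mem_preimage]
    constructor
    · intro hx
      obtain ⟨n, hn⟩ := exists_mem_compactCovering (⟨x, hAF hx⟩ : F)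
      exact ⟨n, ⟨⟨x, hAF hx⟩, hn⟩, hx, rfl⟩
    · rintro ⟨n, y, hy, rfl⟩
      exact hy
  rw [h]
  refine AnalyticSet.iUnion fun n => ?_
  have : CompactSpace (compactCovering F n) :=
    isCompact_iff_compactSpace.1 (isCompact_compactCovering F n)
  have hcont : Continuous fun x : (compactCovering F n) => ((x : F) : Y) :=
    continuous_subtype_val.comp continuous_subtype_val
  exact (hcont.measurable hA).analyticSet.image_of_continuous hcont

theorem secondCountableTopology_of_measure_ball {Y : Type*} [MetricSpace Y]
    [MeasurableSpace Y] [OpensMeasurableSpace Y] {μ : Measure Y}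
    (hball : ∀ (x : Y) (r : ℝ), 0 < r → 0 < μ (Metric.ball x r) ∧ μ (Metric.ball x r) < ⊤) :
    SecondCountableTopology Y := by
  rcases isEmpty_or_nonempty Y with _ | ⟨⟨x₀⟩⟩
  · infer_instance
  have hσ : SigmaFinite μ := ⟨⟨{
    set := fun n => ball x₀ (n + 1)
    set_mem := fun _ => trivial
    finite := fun n => (hball x₀ _ (by positivity)).2
    spanning := by
      refine eq_univ_of_forall fun x => mem_iUnion.2 ?_
      obtain ⟨n, hn⟩ := exists_nat_gt (dist x x₀)
      exact ⟨n, mem_ball.2 (hn.trans (lt_add_one _))⟩ }⟩⟩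
  refine secondCountable_of_almost_dense_set fun ε hε => ?_
  obtain ⟨u, -, hdisj, hcov⟩ := Vitali.exists_disjoint_subfamily_covering_enlargement_closedBall
    (univ : Set Y) id (fun _ => ε / 4) (ε / 4) (fun _ _ => le_rfl) 4 (by norm_num)
  refine ⟨u, ?_, fun x => ?_⟩
  · have h := Measure.countable_meas_pos_of_disjoint_iUnion (μ := μ)
      (As := fun a : u => closedBall (a : Y) (ε / 4)) (fun _ => isClosed_closedBall.measurableSet)
      (fun a b hab => hdisj a.2 b.2 fun h => hab (Subtype.ext h))
    have : {a : u | 0 < μ (closedBall (a : Y) (ε / 4))} = univ := eq_univ_of_forall fun a =>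
      (hball a _ (by positivity)).1.trans_le (measure_mono ball_subset_closedBall)
    rw [this, countable_univ_iff] at h
    exact countable_coe_iff.1 h
  · obtain ⟨y, hy, hxy⟩ := hcov x (mem_univ x)
    refine ⟨y, hy, ?_⟩
    have := hxy (mem_closedBall_self (by positivity))
    simpa [mul_div_cancel₀] using this

omit [BorelSpace X] in
theorem ZeroModulus.mono {p : ℝ} {μ : Measure X} {Γ Γ' : Set (Curve X)} (h : ZeroModulus p μ Γ)
    (hΓ : Γ' ⊆ Γ) : ZeroModulus p μ Γ' := by
  obtain ⟨ρ, hρ, hfin, htop⟩ := h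
  exact ⟨ρ, hρ, hfin, fun γ hγ => htop γ (hΓ hγ)⟩

omit [BorelSpace X] in
theorem ZeroModulus.iUnion {p : ℝ} (hp : 0 < p) {μ : Measure X} {Γ : ℕ → Set (Curve X)}
    (h : ∀ n, ZeroModulus p μ (Γ n)) : ZeroModulus p μ (⋃ n, Γ n) := by
  choose ρ hρ hfin htop using h
  obtain ⟨δ, hδ, hsum⟩ := ENNReal.exists_pos_tsum_mul_lt_of_countable one_ne_zero
    (fun n => ∫⁻ x, ρ n x ^ p ∂μ) (fun n => (hfin n).ne)
  refine ⟨fun x => ⨆ n, (δ n : ℝ≥0∞) ^ p⁻¹ * ρ n x,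
    Measurable.iSup fun n => (hρ n).const_mul _, ?_, ?_⟩
  · have hle : ∀ x, (⨆ n, (δ n : ℝ≥0∞) ^ p⁻¹ * ρ n x) ^ p ≤ ∑' n, ρ n x ^ p * δ n := fun x => by
      rw [← ENNReal.le_rpow_inv_iff hp]
      refine iSup_le fun n => ?_
      rw [ENNReal.le_rpow_inv_iff hp, ENNReal.mul_rpow_of_nonneg _ _ hp.le, ← ENNReal.rpow_mul,
        inv_mul_cancel₀ hp.ne', ENNReal.rpow_one, mul_comm]
      exact ENNReal.le_tsum (f := fun n => ρ n x ^ p * δ n) n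
    calc _ ≤ ∫⁻ x, ∑' n, ρ n x ^ p * δ n ∂μ := lintegral_mono hle
      _ = ∑' n, (∫⁻ x, ρ n x ^ p ∂μ) * δ n := by
        rw [lintegral_tsum fun n => (((hρ n).pow_const p).mul_const _).aemeasurable]
        exact tsum_congr fun n => lintegral_mul_const _ ((hρ n).pow_const p)
      _ < ⊤ := hsum.trans ENNReal.one_lt_top
  · intro γ hγ
    obtain ⟨n, hn⟩ := mem_iUnion.1 hγ
    rw [eq_top_iff]
    calc ⊤ = (δ n : ℝ≥0∞) ^ p⁻¹ * γ.integral (ρ n) := by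
          rw [htop n γ hn, ENNReal.mul_top]
          simp [ENNReal.rpow_eq_zero_iff, (hδ n).ne']
      _ ≤ γ.integral fun x => (δ n : ℝ≥0∞) ^ p⁻¹ * ρ n x := lintegral_const_mul_le _ _
      _ ≤ _ := lintegral_mono fun t => le_iSup (fun n => (δ n : ℝ≥0∞) ^ p⁻¹ * ρ n (γ.toFun t)) n

omit [BorelSpace X] in
theorem ZeroModulus.union {p : ℝ} (hp : 0 < p) {μ : Measure X} {Γ Γ' : Set (Curve X)}
    (h : ZeroModulus p μ Γ) (h' : ZeroModulus p μ Γ') : ZeroModulus p μ (Γ ∪ Γ') := by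
  refine (ZeroModulus.iUnion hp (Γ := fun n => if n = 0 then Γ else Γ') fun n => ?_).mono ?_
  · split_ifs
    exacts [h, h']
  · rintro γ (hγ | hγ)
    · exact mem_iUnion.2 ⟨0, hγ⟩
    · exact mem_iUnion.2 ⟨1, hγ⟩

/-- The upper gradient inequality for a `[0, ∞]`-valued function along the curve `γ`, written
without subtraction. -/
def ENNRealUGOn (u g : X → ℝ≥0∞) (γ : Curve X) : Prop :=
  u (γ.toFun 0) ≤ u (γ.toFun γ.len) + γ.integral g ∧
    u (γ.toFun γ.len) ≤ u (γ.toFun 0) + γ.integral g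

/-- `u` is a test function with values in `[0, 1]` for the capacity of `G` in `E`, and `g` is a
`p`-weak upper gradient of `u`. -/
structure IsCapacityCompetitor (p : ℝ) (μ : Measure X) (G E : Set X) (u g : X → ℝ≥0∞) : Prop where
  aemeasurable : AEMeasurable u μ
  le_one : ∀ x, u x ≤ 1
  eq_zero : ∀ x ∉ E, u x = 0
  eq_one : ∀ x ∈ G, u x = 1
  measurable : Measurable g
  zeroModulus : ZeroModulus p μ {γ | ¬ ENNRealUGOn u g γ}

theorem ugDiff_coe_le {a b I : ℝ≥0∞} (ha : a ≠ ⊤) (hb : b ≠ ⊤) (h₁ : a ≤ b + I) (h₂ : b ≤ a + I) :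
    ugDiff (a : EReal) (b : EReal) ≤ I := by
  rcases eq_or_ne I ⊤ with rfl | hI
  · exact le_top
  lift a to ℝ≥0 using ha
  lift b to ℝ≥0 using hb
  lift I to ℝ≥0 using hI
  have e : ∀ c : ℝ≥0, ((c : ℝ≥0∞) : EReal) = ((c : ℝ) : EReal) := fun _ => rfl
  have h₁' : (a : ℝ) ≤ b + I := by exact_mod_cast h₁
  have h₂' : (b : ℝ) ≤ a + I := by exact_mod_cast h₂
  rw [ugDiff, if_neg (by simp [e, (EReal.abs_coe_lt_top _).ne]), e, e, ← EReal.coe_sub,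
    EReal.abs_def]
  exact ENNReal.ofReal_le_of_le_toReal (by
    rw [ENNReal.coe_toReal, abs_le]; constructor <;> linarith)

theorem toENNReal_le_add_of_ugDiff_le {a b : EReal} {I : ℝ≥0∞} (h : ugDiff a b ≤ I) :
    a.toENNReal ≤ b.toENNReal + I ∧ b.toENNReal ≤ a.toENNReal + I := by
  rcases eq_or_ne I ⊤ with rfl | hI
  · simp
  unfold ugDiff at h
  split_ifs at h with h'
  · exact absurd (top_le_iff.1 h) hI
  rw [not_or] at h'
  induction a with
  | bot => simp at h'
  | top => simp at h'
  | coe a =>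
    induction b with
    | bot => simp at h'
    | top => simp at h'
    | coe b =>
      rw [← EReal.coe_sub, EReal.abs_def] at h
      simp only [EReal.real_coe_toENNReal]
      constructor
      · calc ENNReal.ofReal a ≤ ENNReal.ofReal (b + |a - b|) :=
              ENNReal.ofReal_le_ofReal (by linarith [le_abs_self (a - b)])
          _ ≤ _ := ENNReal.ofReal_add_le.trans (by gcongr)
      · calc ENNReal.ofReal b ≤ ENNReal.ofReal (a + |a - b|) :=
              ENNReal.ofReal_le_ofReal (by linarith [neg_abs_le (a - b)])
          _ ≤ _ := ENNReal.ofReal_add_le.trans (by gcongr)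

theorem min_one_le_add {a b I : ℝ≥0∞} (h : a ≤ b + I) : min a 1 ≤ min b 1 + I := by
  rw [min_add]
  exact min_le_min h le_self_add

omit [BorelSpace X] in
theorem IsCapacityCompetitor.varCapacity_le {p : ℝ} (hp : 0 < p) {μ : Measure X} {G E : Set X}
    (hμE : μ E ≠ ⊤) {u g : X → ℝ≥0∞} (h : IsCapacityCompetitor p μ G E u g) :
    varCapacity p μ G E ≤ ∫⁻ x, g x ^ p ∂μ := by
  rcases eq_or_ne (∫⁻ x, g x ^ p ∂μ) ⊤ with htop | htop
  · exact htop ▸ le_top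
  have hne : ∀ x, u x ≠ ⊤ := fun x => ((h.le_one x).trans_lt ENNReal.one_lt_top).ne
  have hwug : IsWeakUpperGradient p μ (fun x => (u x : EReal)) g :=
    ⟨h.measurable, h.zeroModulus.mono fun γ hγ hug =>
      hγ (ugDiff_coe_le (hne _) (hne _) hug.1 hug.2)⟩
  have henergy : gradEnergy p μ (fun x => (u x : EReal)) ≤ ∫⁻ x, g x ^ p ∂μ := iInf₂_le g hwug
  refine (iInf₂_le (fun x => (u x : EReal)) ⟨⟨⟨?_, ?_⟩, ?_⟩, ?_⟩).trans henergy
  · exact measurable_coe_ennreal_ereal.comp_aemeasurable h.aemeasurable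
  · refine ENNReal.add_lt_top.2 ⟨?_, henergy.trans_lt htop.lt_top⟩
    have habs : ∀ x, ((u x : EReal)).abs = u x := fun x => by
      lift u x to ℝ≥0 using hne x with c
      exact (EReal.abs_def c).trans (by simp)
    calc ∫⁻ x, ((u x : EReal)).abs ^ p ∂μ ≤ ∫⁻ x, (toMeasurable μ E).indicator 1 x ∂μ := by
          refine lintegral_mono fun x => ?_
          rw [habs]
          by_cases hx : x ∈ toMeasurable μ E
          · rw [indicator_of_mem hx]
            exact ENNReal.rpow_le_one (h.le_one x) hp.le
          · rw [h.eq_zero x fun hxE => hx (subset_toMeasurable μ E hxE),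
              ENNReal.zero_rpow_of_pos hp]
            exact zero_le
      _ = μ E := by
        rw [lintegral_indicator_one (measurableSet_toMeasurable _ _), measure_toMeasurable]
      _ < ⊤ := hμE.lt_top
  · intro x hx
    simp [h.eq_zero x hx]
  · intro x hx
    simp [h.eq_one x hx]

omit [BorelSpace X] in
theorem exists_isCapacityCompetitor_of_varCapacity_lt {p : ℝ} {μ : Measure X} {G E : Set X}
    {t : ℝ≥0∞} (h : varCapacity p μ G E < t) :
    ∃ u g, IsCapacityCompetitor p μ G E u g ∧ ∫⁻ x, g x ^ p ∂μ < t := by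
  simp only [varCapacity, gradEnergy, iInf_lt_iff] at h
  obtain ⟨u, ⟨⟨⟨hu, -⟩, hE⟩, hG⟩, g, ⟨hg, hΓ⟩, hlt⟩ := h
  refine ⟨fun x => min (u x).toENNReal 1, g, ⟨?_, fun x => min_le_right _ _, fun x hx => ?_,
    fun x hx => ?_, hg, hΓ.mono fun γ hγ hug => hγ ?_⟩, hlt⟩
  · exact (measurable_ereal_toENNReal.comp_aemeasurable hu).min aemeasurable_const
  · simp [hE x hx]
  · have hone : (1 : EReal).toENNReal = 1 := by
      simpa using EReal.toENNReal_coe (x := 1)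
    exact min_eq_right (hone.symm.le.trans (EReal.toENNReal_le_toENNReal (hG x hx)))
  · have := toENNReal_le_add_of_ugDiff_le hug
    exact ⟨min_one_le_add this.1, min_one_le_add this.2⟩

omit [BorelSpace X] in
theorem IsCapacityCompetitor.half_add {p : ℝ} (hp : 0 < p) {μ : Measure X} {G₁ G₂ E : Set X}
    {u₁ u₂ g₁ g₂ : X → ℝ≥0∞} (h₁ : IsCapacityCompetitor p μ G₁ E u₁ g₁)
    (h₂ : IsCapacityCompetitor p μ G₂ E u₂ g₂) :
    IsCapacityCompetitor p μ (G₁ ∩ G₂) E (fun x => (u₁ x + u₂ x) / 2)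
      (fun x => (g₁ x + g₂ x) / 2) := by
  have hone : ((1 : ℝ≥0∞) + 1) / 2 = 1 := by
    rw [one_add_one_eq_two, ENNReal.div_self two_ne_zero (by simp)]
  refine ⟨(h₁.aemeasurable.add h₂.aemeasurable).div_const _, fun x => ?_, fun x hx => ?_,
    fun x hx => ?_, (h₁.measurable.add h₂.measurable).div_const _,
    (h₁.zeroModulus.union hp h₂.zeroModulus).mono fun γ hγ => ?_⟩
  · refine le_trans ?_ hone.le
    gcongr
    exacts [h₁.le_one x, h₂.le_one x]
  · simp [h₁.eq_zero x hx, h₂.eq_zero x hx]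
  · simp only [h₁.eq_one x hx.1, h₂.eq_one x hx.2, hone]
  · by_contra hcon
    simp only [mem_union, mem_ofPred_eq, not_or, not_not] at hcon
    have hint : (γ.integral g₁ + γ.integral g₂) / 2 ≤ γ.integral fun x => (g₁ x + g₂ x) / 2 := by
      simp only [ENNReal.div_eq_inv_mul, Curve.integral]
      refine le_trans ?_ (lintegral_const_mul_le _ _)
      gcongr
      exact le_lintegral_add _ _
    have key : ∀ {a b c d : ℝ≥0∞}, a ≤ c + γ.integral g₁ → b ≤ d + γ.integral g₂ →
        (a + b) / 2 ≤ (c + d) / 2 + γ.integral fun x => (g₁ x + g₂ x) / 2 := by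
      intro a b c d hac hbd
      refine le_trans ?_ (add_le_add_right hint _)
      rw [← ENNReal.add_div, add_add_add_comm]
      gcongr
    exact hγ ⟨key hcon.1.1 hcon.2.1, key hcon.1.2 hcon.2.2⟩

omit [BorelSpace X] in
theorem IsCapacityCompetitor.iSup {p : ℝ} (hp : 0 < p) {μ : Measure X} {G : ℕ → Set X} {E : Set X}
    {u g : ℕ → X → ℝ≥0∞} (h : ∀ n, IsCapacityCompetitor p μ (G n) E (u n) (g n)) :
    IsCapacityCompetitor p μ (⋃ n, G n) E (fun x => ⨆ n, u n x) (fun x => ⨆ n, g n x) := by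
  refine ⟨AEMeasurable.iSup fun n => (h n).aemeasurable, fun x => iSup_le fun n => (h n).le_one x,
    fun x hx => ?_, fun x hx => ?_, Measurable.iSup fun n => (h n).measurable,
    (ZeroModulus.iUnion hp fun n => (h n).zeroModulus).mono fun γ hγ => ?_⟩
  · simp [(h _).eq_zero x hx]
  · obtain ⟨n, hn⟩ := mem_iUnion.1 hx
    exact le_antisymm (iSup_le fun n => (h n).le_one x)
      (((h n).eq_one x hn).ge.trans (le_iSup (fun n => u n x) n))
  · by_contra hcon
    simp only [mem_iUnion, mem_ofPred_eq, not_exists, not_not] at hcon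
    have hint : ∀ n, γ.integral (g n) ≤ γ.integral fun x => ⨆ n, g n x := fun n =>
      lintegral_mono fun t => le_iSup (fun n => g n (γ.toFun t)) n
    exact hγ ⟨iSup_le fun n => (hcon n).1.trans
        (add_le_add (le_iSup (fun n => u n (γ.toFun γ.len)) n) (hint n)),
      iSup_le fun n => (hcon n).2.trans
        (add_le_add (le_iSup (fun n => u n (γ.toFun 0)) n) (hint n))⟩

omit [BorelSpace X] in
theorem varCapacityT_mono {p : ℝ} {μ : Measure X} {E A B : Set X} (h : A ⊆ B) :
    varCapacityT p μ A E ≤ varCapacityT p μ B E :=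
  le_iInf₂ fun G hG => iInf₂_le G ⟨h.trans hG.1, hG.2⟩

omit [BorelSpace X] in
theorem varCapacityT_le_varCapacity {p : ℝ} {μ : Measure X} {E A U : Set X} (hU : IsOpen U)
    (hA : A ⊆ U ∩ E) : varCapacityT p μ A E ≤ varCapacity p μ (U ∩ E) E :=
  iInf₂_le _ ⟨hA, inter_subset_right, U, hU, rfl⟩

omit [BorelSpace X] in
theorem exists_isOpen_of_varCapacityT_lt {p : ℝ} {μ : Measure X} {E A : Set X} {t : ℝ≥0∞}
    (h : varCapacityT p μ A E < t) :
    ∃ U, IsOpen U ∧ A ⊆ U ∩ E ∧ varCapacity p μ (U ∩ E) E < t := by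
  simp only [varCapacityT, iInf_lt_iff] at h
  obtain ⟨_, ⟨hA, -, U, hU, rfl⟩, hlt⟩ := h
  exact ⟨U, hU, hA, hlt⟩

omit [BorelSpace X] in
theorem varCapacityT_iUnion_le {p : ℝ} (hp : 1 < p) {μ : Measure X} {E : Set X} (hμE : μ E ≠ ⊤)
    {A : ℕ → Set X} (hA : Monotone A) :
    varCapacityT p μ (⋃ n, A n) E ≤ ⨆ n, varCapacityT p μ (A n) E := by
  have hp0 : 0 < p := by linarith
  refine le_of_forall_gt_imp_ge_of_dense fun d' hd' => ?_
  have hlt : ∀ n, varCapacityT p μ (A n) E < (⨆ n, varCapacityT p μ (A n) E) + (n : ℝ≥0∞)⁻¹ :=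
    fun n => (le_iSup (fun n => varCapacityT p μ (A n) E) n).trans_lt
      (ENNReal.lt_add_right hd'.ne_top (by simp))
  choose U hU hAU hcap using fun n => exists_isOpen_of_varCapacityT_lt (hlt n)
  choose u g hug hg using fun n => exists_isCapacityCompetitor_of_varCapacity_lt (hcap n)
  obtain ⟨k, hk, hle⟩ := exists_subseq_lintegral_iSup_rpow_le (ν := μ) hp
    (fun n => (hug n).measurable) hd' (fun n => le_iSup (fun n => varCapacityT p μ (A n) E) n)
    (tendsto_atTop_iSup fun m n hmn => varCapacityT_mono (hA hmn))
    ENNReal.tendsto_inv_nat_nhds_zero (fun n => (hg n).le) (fun i m him => by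
      have h := ((hug i).half_add hp0 (hug m)).varCapacity_le hp0 hμE
      rw [← inter_inter_distrib_right] at h
      refine (varCapacityT_le_varCapacity ((hU i).inter (hU m)) ?_).trans h
      rw [inter_inter_distrib_right]
      exact subset_inter (hAU i) ((hA him).trans (hAU m)))
  have h := (IsCapacityCompetitor.iSup hp0 fun j => hug (k j)).varCapacity_le hp0 hμE
  rw [← iUnion_inter] at h
  refine (varCapacityT_le_varCapacity (isOpen_iUnion fun j => hU (k j)) ?_).trans (h.trans hle)
  rw [iUnion_inter]
  exact iUnion_mono fun n => (hA (hk.le_apply)).trans (hAU (k n))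

/-- Choquet's capacitability theorem for `~cap_p`: Borel sets `A ⊆ E`
contained in some locally compact `F ⊆ E` are capacitable, with no additional
assumptions on `X`. -/
theorem stmt_18 (p : ℝ) (hp : 1 < p) (μ : Measure X)
    (hball : ∀ (x : X) (r : ℝ), 0 < r → 0 < μ (Metric.ball x r) ∧ μ (Metric.ball x r) < ⊤)
    (E : Set X) (hE : Bornology.IsBounded E)
    (A : Set X) (hAE : A ⊆ E) (hBorel : MeasurableSet A)
    (hF : ∃ F : Set X, A ⊆ F ∧ F ⊆ E ∧ LocallyCompactSpace F) :
    varCapacityT p μ A E =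
        (⨆ (K : Set X) (_ : IsCompact K ∧ K ⊆ A), varCapacityT p μ K E) ∧
      varCapacityT p μ A E =
        ⨅ (G : Set X) (_ : A ⊆ G ∧ G ⊆ E ∧ ∃ U : Set X, IsOpen U ∧ G = U ∩ E),
          varCapacityT p μ G E := by
  have hsc := secondCountableTopology_of_measure_ball hball
  have hμE : μ E ≠ ⊤ := by
    rcases E.eq_empty_or_nonempty with rfl | ⟨x, -⟩
    · simp
    · obtain ⟨r, hr, hEr⟩ := hE.subset_ball_lt 0 x
      exact ((measure_mono hEr).trans_lt (hball x r hr).2).ne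
  obtain ⟨F, hAF, -, hFlc⟩ := hF
  refine ⟨le_antisymm ?_ (iSup₂_le fun K hK => varCapacityT_mono hK.2), le_antisymm
    (le_iInf₂ fun G hG => varCapacityT_mono hG.1)
    (iInf₂_mono fun G hG => iInf₂_le G ⟨Subset.rfl, hG.2⟩)⟩
  refine (hBorel.analyticSet_of_subset_locallyCompact hAF).le_iSup_isCompact_of_capacity
    (C := fun B => varCapacityT p μ B E) (fun _ _ h => varCapacityT_mono h)
    (fun s hs => varCapacityT_iUnion_le hp hμE hs) fun K _ _ t ht => ?_
  obtain ⟨U, hU, hKU, hUt⟩ := exists_isOpen_of_varCapacityT_lt ht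
  exact ⟨U, hU, hKU.trans inter_subset_left,
    (varCapacityT_le_varCapacity hU (inter_subset_inter_right U hAE)).trans_lt hUt⟩

end
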